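/- arXiv:2006.04710 — 2 statements merged into one kernel-verified Lean document; each statement's English description precedes it below -/
import Mathlib

section
/- A single head of L2 self-attention with tied query and key weights is Lipschitz with respect to the ℓ∞ norm, with Lipschitz constant at most ‖W^Q‖_∞ ‖W^{Q⊤}‖_∞ (4c + 1/√D'). That is, for all X, X' ∈ ℝ^{N×D}, max_{i,d} |f(X)_{id} − f(X')_{id}| ≤ ‖W^Q‖_∞ ‖W^{Q⊤}‖_∞ (4c + 1/√D') · max_{i,d} |X_{id} − X'_{id}|. -/
open Matrix BigOperators

/-- ℓ∞ norm of a matrix viewed as a vector: the maximum absolute entry. -/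
noncomputable def maxEntry {m n : Type*} [Fintype m] [Fintype n] (M : Matrix m n ℝ) : ℝ :=
  ⨆ i, ⨆ j, |M i j|

/-- The operator norm induced by the vector ℓ∞ norm: the maximum absolute row sum. -/
noncomputable def maxRowSum {m n : Type*} [Fintype m] [Fintype n] (M : Matrix m n ℝ) : ℝ :=
  ⨆ i, ∑ j, |M i j|

/-- A single head of L2 self-attention with tied query/key weights:
`f(X) = P X A` where `P i j ∝ exp(−‖WQᵀ(xᵢ − xⱼ)‖₂²/√D')` and
`A = WQ WQᵀ / √D'`. -/
noncomputable def l2Head {N D D' : ℕ} (WQ : Matrix (Fin D) (Fin D') ℝ)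
    (X : Matrix (Fin N) (Fin D) ℝ) : Matrix (Fin N) (Fin D) ℝ :=
  (Matrix.of fun i j =>
    Real.exp (-(∑ m, (WQᵀ.mulVec (X i - X j) m) ^ 2) / Real.sqrt D') /
      ∑ k, Real.exp (-(∑ m, (WQᵀ.mulVec (X i - X k) m) ^ 2) / Real.sqrt D')) *
    X * ((Real.sqrt D')⁻¹ • (WQ * WQᵀ))

section MaxEntry

variable {l m n : Type*} [Fintype l] [Fintype m] [Fintype n]

theorem abs_apply_le_maxEntry (M : Matrix m n ℝ) (i : m) (j : n) : |M i j| ≤ maxEntry M :=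
  (le_ciSup (f := fun j => |M i j|) (Set.finite_range _).bddAbove j).trans
    (le_ciSup (f := fun i => ⨆ j, |M i j|) (Set.finite_range _).bddAbove i)

theorem maxEntry_nonneg (M : Matrix m n ℝ) : 0 ≤ maxEntry M :=
  Real.iSup_nonneg fun _ => Real.iSup_nonneg fun _ => abs_nonneg _

theorem maxEntry_le {M : Matrix m n ℝ} {a : ℝ} (ha : 0 ≤ a) (h : ∀ i j, |M i j| ≤ a) :
    maxEntry M ≤ a :=
  Real.iSup_le (fun i => Real.iSup_le (h i) ha) ha

theorem row_sum_le_maxRowSum (M : Matrix m n ℝ) (i : m) : ∑ j, |M i j| ≤ maxRowSum M :=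
  le_ciSup (f := fun i => ∑ j, |M i j|) (Set.finite_range _).bddAbove i

theorem maxRowSum_nonneg (M : Matrix m n ℝ) : 0 ≤ maxRowSum M :=
  Real.iSup_nonneg fun _ => Finset.sum_nonneg fun _ _ => abs_nonneg _

theorem maxEntry_mul_le (A : Matrix l m ℝ) (B : Matrix m n ℝ) :
    maxEntry (A * B) ≤ maxRowSum Bᵀ * maxEntry A := by
  refine maxEntry_le (mul_nonneg (maxRowSum_nonneg _) (maxEntry_nonneg _)) fun i j => ?_
  calc |(A * B) i j| ≤ ∑ k, |A i k * B k j| := by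
        rw [Matrix.mul_apply]; exact Finset.abs_sum_le_sum_abs _ _
    _ ≤ ∑ k, |Bᵀ j k| * maxEntry A := by
        refine Finset.sum_le_sum fun k _ => ?_
        rw [abs_mul, mul_comm, Matrix.transpose_apply]
        exact mul_le_mul_of_nonneg_left (abs_apply_le_maxEntry A i k) (abs_nonneg _)
    _ ≤ maxRowSum Bᵀ * maxEntry A := by
        rw [← Finset.sum_mul]
        exact mul_le_mul_of_nonneg_right (row_sum_le_maxRowSum Bᵀ j) (maxEntry_nonneg _)

theorem maxEntry_smul {a : ℝ} (ha : 0 ≤ a) (M : Matrix m n ℝ) :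
    maxEntry (a • M) = a * maxEntry M := by
  simp only [maxEntry, Matrix.smul_apply, smul_eq_mul, abs_mul, abs_of_nonneg ha,
    Real.mul_iSup_of_nonneg ha]

end MaxEntry

theorem sub_mul_exp_neg_le (u c : ℝ) : (u - c) * Real.exp (-u) ≤ Real.exp (-(c + 1)) := by
  have h : u - c ≤ Real.exp (u - c - 1) := by linarith [Real.add_one_le_exp (u - c - 1)]
  calc (u - c) * Real.exp (-u) ≤ Real.exp (u - c - 1) * Real.exp (-u) :=
        mul_le_mul_of_nonneg_right h (Real.exp_pos _).le
    _ = Real.exp (-(c + 1)) := by rw [← Real.exp_add]; ring_nf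

theorem sum_mul_exp_neg_le {ι : Type*} [Fintype ι] {c : ℝ}
    (hc : c * Real.exp (c + 1) = (Fintype.card ι : ℝ) - 1) {u : ι → ℝ} {i : ι} (hi : u i = 0) :
    ∑ j, u j * Real.exp (-u j) ≤ c * ∑ j, Real.exp (-u j) := by
  classical
  have h : ∑ j ∈ Finset.univ.erase i, (u j - c) * Real.exp (-u j) ≤ c := by
    calc _ ≤ ∑ _j ∈ Finset.univ.erase i, Real.exp (-(c + 1)) :=
          Finset.sum_le_sum fun j _ => sub_mul_exp_neg_le _ _
      _ = ((Fintype.card ι : ℝ) - 1) * Real.exp (-(c + 1)) := by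
          rw [Finset.sum_const, nsmul_eq_mul, Finset.cast_card_erase_of_mem (Finset.mem_univ i),
            Finset.card_univ]
      _ = c := by rw [← hc, mul_assoc, ← Real.exp_add]; simp
  have hsplit := Finset.add_sum_erase Finset.univ
    (fun j => (u j - c) * Real.exp (-u j)) (Finset.mem_univ i)
  simp only [hi, neg_zero, Real.exp_zero, sub_mul, Finset.sum_sub_distrib, ← Finset.mul_sum]
    at hsplit h
  linarith

theorem abs_sum_mul_sub_mean_le {ι : Type*} [Fintype ι] {w v g r : ι → ℝ} {μ a K : ℝ}
    (hw : ∀ j, 0 ≤ w j) (hK : 0 ≤ K) (hg : ∀ j, |g j| ≤ K * r j)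
    (hv : ∀ j, (v j - a) ^ 2 ≤ r j ^ 2) (hμ : μ * ∑ j, w j = ∑ j, w j * v j) :
    |∑ j, w j * g j * (v j - μ)| ≤ K * ∑ j, w j * r j ^ 2 := by
  have hterm : ∀ j, |w j * g j * (v j - μ)| ≤ K / 2 * (w j * r j ^ 2 + w j * (v j - μ) ^ 2) := by
    intro j
    rw [abs_mul, abs_mul, abs_of_nonneg (hw j), ← sq_abs (v j - μ)]
    have h1 : |g j| * |v j - μ| ≤ K / 2 * (r j ^ 2 + |v j - μ| ^ 2) := by
      calc _ ≤ K * r j * |v j - μ| := mul_le_mul_of_nonneg_right (hg j) (abs_nonneg _)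
        _ ≤ _ := by nlinarith [mul_nonneg hK (sq_nonneg (r j - |v j - μ|))]
    nlinarith [mul_le_mul_of_nonneg_left h1 (hw j)]
  have hvar : ∑ j, w j * (v j - μ) ^ 2 ≤ ∑ j, w j * r j ^ 2 := by
    have hsteiner : ∑ j, w j * (v j - a) ^ 2 - ∑ j, w j * (v j - μ) ^ 2
        = (μ - a) ^ 2 * ∑ j, w j := by
      have : ∀ j, w j * (v j - a) ^ 2 - w j * (v j - μ) ^ 2
          = 2 * (μ - a) * (w j * v j) + (a ^ 2 - μ ^ 2) * w j := fun j => by ring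
      rw [← Finset.sum_sub_distrib, Finset.sum_congr rfl fun j _ => this j,
        Finset.sum_add_distrib, ← Finset.mul_sum, ← Finset.mul_sum, ← hμ]
      ring
    have hnonneg : 0 ≤ (μ - a) ^ 2 * ∑ j, w j :=
      mul_nonneg (sq_nonneg _) (Finset.sum_nonneg fun j _ => hw j)
    have hle : ∑ j, w j * (v j - a) ^ 2 ≤ ∑ j, w j * r j ^ 2 :=
      Finset.sum_le_sum fun j _ => mul_le_mul_of_nonneg_left (hv j) (hw j)
    linarith
  calc _ ≤ ∑ j, |w j * g j * (v j - μ)| := Finset.abs_sum_le_sum_abs _ _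
    _ ≤ ∑ j, K / 2 * (w j * r j ^ 2 + w j * (v j - μ) ^ 2) := Finset.sum_le_sum fun j _ => hterm j
    _ = K / 2 * (∑ j, w j * r j ^ 2 + ∑ j, w j * (v j - μ) ^ 2) := by
        rw [← Finset.mul_sum, Finset.sum_add_distrib]
    _ ≤ _ := by nlinarith

section GaussianAverage

variable {ι κ : Type*} [Fintype κ]

/-- The derivative of the exponents of `gaussianAverage` in the direction `E`. -/
noncomputable def exponentDeriv (s : ℝ) (Y E : Matrix ι κ ℝ) (i j : ι) : ℝ :=
  -(∑ k, 2 * (Y i k - Y j k) * (E i k - E j k)) / s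

theorem abs_exponentDeriv_le {s δ : ℝ} (hs : 0 < s) (hcard : s ^ 2 = Fintype.card κ)
    {Y E : Matrix ι κ ℝ} (hδ : 0 ≤ δ) (hE : ∀ i k, |E i k| ≤ δ) (i j : ι) :
    |exponentDeriv s Y E i j| ≤ 4 * δ * Real.sqrt (∑ k, (Y i k - Y j k) ^ 2) := by
  have hl1 : ∑ k, |Y i k - Y j k| ≤ s * Real.sqrt (∑ k, (Y i k - Y j k) ^ 2) := by
    refine abs_le_of_sq_le_sq' ?_ (by positivity) |>.2
    rw [mul_pow, Real.sq_sqrt (Finset.sum_nonneg fun _ _ => sq_nonneg _), hcard]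
    simpa [sq_abs] using sq_sum_le_card_mul_sum_sq (s := Finset.univ)
      (f := fun k => |Y i k - Y j k|)
  rw [exponentDeriv, abs_div, abs_neg, abs_of_pos hs, div_le_iff₀ hs]
  calc _ ≤ ∑ k, |2 * (Y i k - Y j k) * (E i k - E j k)| := Finset.abs_sum_le_sum_abs _ _
    _ ≤ ∑ k, 4 * δ * |Y i k - Y j k| := by
        refine Finset.sum_le_sum fun k _ => ?_
        have h : |E i k - E j k| ≤ 2 * δ := by
          linarith [abs_sub (E i k) (E j k), hE i k, hE j k]
        rw [abs_mul, abs_mul, abs_two]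
        nlinarith [mul_le_mul_of_nonneg_left h (abs_nonneg (Y i k - Y j k))]
    _ ≤ _ := by
        rw [← Finset.mul_sum]
        nlinarith [mul_le_mul_of_nonneg_left hl1 (by positivity : 0 ≤ 4 * δ)]

variable [Fintype ι]

/-- The average of the rows of `Y`, the `j`-th row being weighted for the `i`-th output by
`exp (-‖Y i - Y j‖₂² / s)`. -/
noncomputable def gaussianAverage (s : ℝ) (Y : Matrix ι κ ℝ) : Matrix ι κ ℝ := fun i m =>
  (∑ j, Real.exp (-(∑ k, (Y i k - Y j k) ^ 2) / s) * Y j m) /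
    ∑ j, Real.exp (-(∑ k, (Y i k - Y j k) ^ 2) / s)

/-- The derivative of `gaussianAverage` in the direction `E`. -/
noncomputable def gaussianAverageDeriv (s : ℝ) (Y E : Matrix ι κ ℝ) : Matrix ι κ ℝ := fun i m =>
  (∑ j, Real.exp (-(∑ k, (Y i k - Y j k) ^ 2) / s) *
      (E j m + exponentDeriv s Y E i j * (Y j m - gaussianAverage s Y i m))) /
    ∑ j, Real.exp (-(∑ k, (Y i k - Y j k) ^ 2) / s)

theorem sum_exp_pos (f : ι → ℝ) (i : ι) : 0 < ∑ j, Real.exp (f j) :=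
  Finset.sum_pos (fun _ _ => Real.exp_pos _) ⟨i, Finset.mem_univ i⟩

theorem hasDerivAt_gaussianAverage (s : ℝ) (Y E : Matrix ι κ ℝ) (i : ι) (m : κ) (t : ℝ) :
    HasDerivAt (fun t : ℝ => gaussianAverage s (Y + t • E) i m)
      (gaussianAverageDeriv s (Y + t • E) E i m) t := by
  have hentry : ∀ j k, HasDerivAt (fun t : ℝ => (Y + t • E) j k) (E j k) t := by
    intro j k
    simpa using ((hasDerivAt_id t).mul_const (E j k)).const_add (Y j k)
  have hexp : ∀ j, HasDerivAt
      (fun t : ℝ => Real.exp (-(∑ k, ((Y + t • E) i k - (Y + t • E) j k) ^ 2) / s))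
      (Real.exp (-(∑ k, ((Y + t • E) i k - (Y + t • E) j k) ^ 2) / s) *
        exponentDeriv s (Y + t • E) E i j) t := by
    intro j
    refine HasDerivAt.exp (HasDerivAt.div_const (HasDerivAt.neg ?_) s)
    refine HasDerivAt.fun_sum fun k _ => ?_
    simpa using ((hentry i k).fun_sub (hentry j k)).fun_pow 2
  have hnum := HasDerivAt.fun_sum (u := Finset.univ) fun j _ => (hexp j).fun_mul (hentry j m)
  have hden := HasDerivAt.fun_sum (u := Finset.univ) fun j _ => hexp j
  have hpos := sum_exp_pos
    (fun j => -(∑ k, ((Y + t • E) i k - (Y + t • E) j k) ^ 2) / s) i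
  refine (hnum.fun_div hden hpos.ne').congr_deriv ?_
  simp only [gaussianAverageDeriv, gaussianAverage, mul_add, mul_sub, Finset.sum_add_distrib,
    Finset.sum_sub_distrib, ← mul_assoc, ← Finset.sum_mul]
  generalize (∑ j, Real.exp (-(∑ k, ((Y + t • E) i k - (Y + t • E) j k) ^ 2) / s)) = Z
    at hpos ⊢
  field_simp
  ring

theorem abs_gaussianAverageDeriv_le {s c δ : ℝ} (hs : 0 < s) (hcard : s ^ 2 = Fintype.card κ)
    (hc : c * Real.exp (c + 1) = (Fintype.card ι : ℝ) - 1)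
    {Y E : Matrix ι κ ℝ} (hδ : 0 ≤ δ) (hE : ∀ i k, |E i k| ≤ δ) (i : ι) (m : κ) :
    |gaussianAverageDeriv s Y E i m| ≤ (4 * c * s + 1) * δ := by
  have hpos := sum_exp_pos (fun j => -(∑ k, (Y i k - Y j k) ^ 2) / s) i
  have hspread : ∑ j, Real.exp (-(∑ k, (Y i k - Y j k) ^ 2) / s) *
      Real.sqrt (∑ k, (Y i k - Y j k) ^ 2) ^ 2 ≤
      s * (c * ∑ j, Real.exp (-(∑ k, (Y i k - Y j k) ^ 2) / s)) := by
    have h := sum_mul_exp_neg_le hc (u := fun j => (∑ k, (Y i k - Y j k) ^ 2) / s) (i := i)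
      (by simp)
    simp only [← neg_div] at h
    refine le_trans (le_of_eq ?_) (mul_le_mul_of_nonneg_left h hs.le)
    rw [Finset.mul_sum]
    refine Finset.sum_congr rfl fun j _ => ?_
    rw [Real.sq_sqrt (Finset.sum_nonneg fun _ _ => sq_nonneg _)]
    field_simp
  have hcov := abs_sum_mul_sub_mean_le
    (w := fun j => Real.exp (-(∑ k, (Y i k - Y j k) ^ 2) / s)) (v := fun j => Y j m)
    (g := exponentDeriv s Y E i) (r := fun j => Real.sqrt (∑ k, (Y i k - Y j k) ^ 2))
    (μ := gaussianAverage s Y i m) (a := Y i m) (K := 4 * δ)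
    (fun j => (Real.exp_pos _).le) (by positivity)
    (abs_exponentDeriv_le hs hcard hδ hE i)
    (fun j => by
      rw [Real.sq_sqrt (Finset.sum_nonneg fun _ _ => sq_nonneg _), ← neg_sub, neg_sq]
      exact Finset.single_le_sum (f := fun k => (Y i k - Y j k) ^ 2)
        (fun _ _ => sq_nonneg _) (Finset.mem_univ m))
    (div_mul_cancel₀ _ hpos.ne')
  have hmean : |∑ j, Real.exp (-(∑ k, (Y i k - Y j k) ^ 2) / s) * E j m| ≤
      δ * ∑ j, Real.exp (-(∑ k, (Y i k - Y j k) ^ 2) / s) := by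
    rw [Finset.mul_sum]
    refine (Finset.abs_sum_le_sum_abs _ _).trans (Finset.sum_le_sum fun j _ => ?_)
    rw [abs_mul, Real.abs_exp, mul_comm]
    exact mul_le_mul_of_nonneg_right (hE j m) (Real.exp_pos _).le
  rw [gaussianAverageDeriv, abs_div, abs_of_pos hpos, div_le_iff₀ hpos]
  simp only [mul_add, Finset.sum_add_distrib, ← mul_assoc]
  refine (abs_add_le _ _).trans ((add_le_add hmean hcov).trans ?_)
  nlinarith [mul_le_mul_of_nonneg_left hspread (by positivity : 0 ≤ 4 * δ)]

theorem maxEntry_gaussianAverage_sub_le {s c : ℝ} (hs : 0 < s)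
    (hcard : s ^ 2 = Fintype.card κ) (hc0 : 0 ≤ c)
    (hc : c * Real.exp (c + 1) = (Fintype.card ι : ℝ) - 1) (Y Y' : Matrix ι κ ℝ) :
    maxEntry (gaussianAverage s Y - gaussianAverage s Y') ≤
      (4 * c * s + 1) * maxEntry (Y - Y') := by
  have hδ := maxEntry_nonneg (Y - Y')
  refine maxEntry_le (by positivity) fun i m => ?_
  have h := Convex.norm_image_sub_le_of_norm_hasDerivWithin_le (s := Set.univ)
    (x := (0 : ℝ)) (y := 1)
    (fun t _ => (hasDerivAt_gaussianAverage s Y' (Y - Y') i m t).hasDerivWithinAt)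
    (fun t _ => abs_gaussianAverageDeriv_le hs hcard hc hδ (abs_apply_le_maxEntry (Y - Y')) i m)
    convex_univ (Set.mem_univ _) (Set.mem_univ _)
  simpa using h

end GaussianAverage

theorem l2Head_eq {N D D' : ℕ} (WQ : Matrix (Fin D) (Fin D') ℝ) (X : Matrix (Fin N) (Fin D) ℝ) :
    l2Head WQ X =
      (Real.sqrt D')⁻¹ • (gaussianAverage (Real.sqrt D') (X * WQ) * WQᵀ) := by
  have hrow : ∀ i m, (WQᵀ *ᵥ X i) m = (X * WQ) i m := by
    intro i m
    simp only [Matrix.mulVec, dotProduct, Matrix.mul_apply, Matrix.transpose_apply, mul_comm]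
  rw [l2Head, Matrix.mul_smul, ← Matrix.mul_assoc, Matrix.mul_assoc _ X WQ]
  congr 2
  ext i m
  simp only [Matrix.mul_apply (N := X * WQ), Matrix.of_apply, gaussianAverage, Matrix.mulVec_sub,
    Pi.sub_apply, hrow, div_mul_eq_mul_div, Finset.sum_div]

/-- A single head of L2 self-attention with tied query/key weights is Lipschitz
w.r.t. the ℓ∞ norm, with constant at most `‖WQ‖_∞ ‖WQᵀ‖_∞ (4c + 1/√D')`,
where `c·exp(c+1) = N − 1`. -/
theorem l2_head_lipschitz_inf
    (N D D' : ℕ) (hN : 2 ≤ N) (hD : 1 ≤ D) (hD' : 1 ≤ D')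
    (WQ : Matrix (Fin D) (Fin D') ℝ)
    (c : ℝ) (hc0 : 0 ≤ c) (hc : c * Real.exp (c + 1) = (N : ℝ) - 1) :
    ∀ X X' : Matrix (Fin N) (Fin D) ℝ,
      maxEntry (l2Head WQ X - l2Head WQ X') ≤
        maxRowSum WQ * maxRowSum WQᵀ * (4 * c + 1 / Real.sqrt D') *
          maxEntry (X - X') := by
  intro X X'
  have hs : 0 < Real.sqrt D' := Real.sqrt_pos.2 (by exact_mod_cast hD')
  have hhead : maxEntry (l2Head WQ X - l2Head WQ X') ≤ (Real.sqrt D')⁻¹ * (maxRowSum WQ *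
      maxEntry (gaussianAverage (Real.sqrt D') (X * WQ) -
        gaussianAverage (Real.sqrt D') (X' * WQ))) := by
    rw [l2Head_eq, l2Head_eq, ← smul_sub, ← Matrix.sub_mul, maxEntry_smul (inv_nonneg.2 hs.le)]
    exact mul_le_mul_of_nonneg_left (maxEntry_mul_le _ WQᵀ) (inv_nonneg.2 hs.le)
  have havg := maxEntry_gaussianAverage_sub_le hs (by simp) hc0 (by simpa using hc)
    (X * WQ) (X' * WQ)
  have hproj : maxEntry (X * WQ - X' * WQ) ≤ maxRowSum WQᵀ * maxEntry (X - X') := by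
    rw [← Matrix.sub_mul]
    exact maxEntry_mul_le _ WQ
  have hW := maxRowSum_nonneg WQ
  calc _ ≤ (Real.sqrt D')⁻¹ * (maxRowSum WQ * ((4 * c * Real.sqrt D' + 1) *
        (maxRowSum WQᵀ * maxEntry (X - X')))) := by
        refine hhead.trans ?_
        gcongr
        refine havg.trans ?_
        gcongr
    _ = _ := by field_simp
end

section
/- The rank-one sum bound in the spectral norm: Σ_{j=1}^N P_{ij} ‖y_j − ȳ‖₂ · ‖y_i − y_j‖₂ ≤ c. Equivalently, Σ_{j=1}^N ‖P_{ij}(y_j − ȳ)(y_i − y_j)⊤‖₂ ≤ c, where ‖·‖₂ on matrices is the spectral norm and ‖u v⊤‖₂ = ‖u‖₂ ‖v‖₂ for vectors u, v. -/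
open BigOperators

/-- The softmax average of `x` with respect to the weights `exp (-x)`, where some entry of `x`
vanishes, is at most `c`. Stated without division by the normalising constant. -/
lemma sum_exp_neg_mul_le {ι : Type*} [Fintype ι] (x : ι → ℝ) {i : ι} (hi : x i = 0) {c : ℝ}
    (hc : c * Real.exp (c + 1) = (Fintype.card ι : ℝ) - 1) :
    ∑ j, Real.exp (-x j) * x j ≤ c * ∑ j, Real.exp (-x j) := by
  classical
  have hle (t : ℝ) : Real.exp (-t) * (t - c) ≤ Real.exp (-(c + 1)) :=
    calc Real.exp (-t) * (t - c) ≤ Real.exp (-t) * Real.exp (t - c - 1) := by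
          gcongr
          linarith [Real.add_one_le_exp (t - c - 1)]
      _ = Real.exp (-(c + 1)) := by rw [← Real.exp_add]; ring_nf
  have hrest : ∑ j ∈ Finset.univ.erase i, Real.exp (-x j) * (x j - c) ≤ c := by
    calc ∑ j ∈ Finset.univ.erase i, Real.exp (-x j) * (x j - c)
        ≤ ∑ _j ∈ Finset.univ.erase i, Real.exp (-(c + 1)) := Finset.sum_le_sum fun j _ => hle (x j)
      _ = ((Fintype.card ι : ℝ) - 1) * Real.exp (-(c + 1)) := by
          rw [Finset.sum_const, Finset.card_erase_of_mem (Finset.mem_univ i), nsmul_eq_mul,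
            Finset.card_univ, Nat.cast_pred (Fintype.card_pos_iff.mpr ⟨i⟩)]
      _ = c := by rw [← hc, mul_assoc, ← Real.exp_add, add_neg_cancel, Real.exp_zero, mul_one]
  have hsum : ∑ j, Real.exp (-x j) * (x j - c) ≤ 0 := by
    rw [← Finset.add_sum_erase _ _ (Finset.mem_univ i), hi, neg_zero, Real.exp_zero]
    linarith
  simp only [mul_sub, Finset.sum_sub_distrib, ← Finset.sum_mul] at hsum
  linarith

/-- Among all centres `a`, the weighted mean minimises the weighted sum of squared deviations. -/
lemma sum_mul_sub_weighted_mean_sq_le {ι : Type*} [Fintype ι] {p : ι → ℝ} (hp : ∑ j, p j = 1)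
    (z : ι → ℝ) (a : ℝ) :
    ∑ j, p j * (z j - ∑ k, p k * z k) ^ 2 ≤ ∑ j, p j * (z j - a) ^ 2 := by
  have expand (b : ℝ) : ∑ j, p j * (z j - b) ^ 2 =
      ∑ j, p j * z j ^ 2 - 2 * b * ∑ j, p j * z j + b ^ 2 := by
    calc ∑ j, p j * (z j - b) ^ 2
        = ∑ j, (p j * z j ^ 2 - 2 * b * (p j * z j) + b ^ 2 * p j) :=
          Finset.sum_congr rfl fun j _ => by ring
      _ = _ := by
          rw [Finset.sum_add_distrib, Finset.sum_sub_distrib, ← Finset.mul_sum, ← Finset.mul_sum,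
            hp, mul_one]
  rw [expand, expand]
  nlinarith [sq_nonneg (a - ∑ k, p k * z k)]

/-- The rank-one sum bound in the spectral norm:
`∑ⱼ Pⱼ ‖yⱼ − ȳ‖₂ ‖yᵢ − yⱼ‖₂ ≤ c`, where `Pⱼ` are the softmax weights
`Pⱼ ∝ exp(−‖yⱼ − yᵢ‖₂²)`, `ȳ = ∑ₖ Pₖ yₖ`, and `c·exp(c+1) = N − 1`.
(Equivalently `∑ⱼ ‖Pⱼ(yⱼ − ȳ)(yᵢ − yⱼ)ᵀ‖₂ ≤ c` since `‖u vᵀ‖₂ = ‖u‖₂‖v‖₂`.) -/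
theorem softmax_rank_one_sum_spec_le
    (N d : ℕ) (hN : 1 ≤ N) (hd : 1 ≤ d)
    (y : Fin N → Fin d → ℝ) (i : Fin N)
    (P : Fin N → ℝ)
    (hP : ∀ j, P j = Real.exp (-(∑ m, (y j m - y i m) ^ 2)) /
      ∑ k, Real.exp (-(∑ m, (y k m - y i m) ^ 2)))
    (ybar : Fin d → ℝ) (hybar : ∀ m, ybar m = ∑ k, P k * y k m)
    (c : ℝ) (hc0 : 0 ≤ c) (hc : c * Real.exp (c + 1) = (N : ℝ) - 1) :
    ∑ j, P j * Real.sqrt (∑ m, (y j m - ybar m) ^ 2) *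
      Real.sqrt (∑ m, (y i m - y j m) ^ 2) ≤ c := by
  set x : Fin N → ℝ := fun j => ∑ m, (y j m - y i m) ^ 2
  have hZ : 0 < ∑ k, Real.exp (-x k) :=
    Finset.sum_pos (fun k _ => Real.exp_pos _) ⟨i, Finset.mem_univ i⟩
  have hP_nonneg (j : Fin N) : 0 ≤ P j := by
    rw [hP]
    exact div_nonneg (Real.exp_pos _).le hZ.le
  have hP_sum : ∑ j, P j = 1 := by
    simp only [hP, ← Finset.sum_div]
    exact div_self hZ.ne'
  have hx : ∑ j, P j * x j ≤ c := by
    have h := sum_exp_neg_mul_le x (i := i) (by simp [x]) (by simpa using hc)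
    simp only [hP, div_mul_eq_mul_div, ← Finset.sum_div]
    exact (div_le_iff₀ hZ).mpr h
  have hvar : ∑ j, P j * ∑ m, (y j m - ybar m) ^ 2 ≤ ∑ j, P j * x j := by
    simp only [x, Finset.mul_sum]
    refine Finset.sum_comm.trans_le ((Finset.sum_le_sum fun m _ => ?_).trans Finset.sum_comm.le)
    rw [hybar]
    exact sum_mul_sub_weighted_mean_sq_le hP_sum (fun j => y j m) (y i m)
  have hterm (j : Fin N) : P j * √(∑ m, (y j m - ybar m) ^ 2) * √(∑ m, (y i m - y j m) ^ 2) ≤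
      (P j * ∑ m, (y j m - ybar m) ^ 2 + P j * x j) / 2 := by
    have hswap : ∑ m, (y i m - y j m) ^ 2 = x j :=
      Finset.sum_congr rfl fun m _ => sub_sq_comm _ _
    have hx_nonneg : 0 ≤ x j := Finset.sum_nonneg fun m _ => sq_nonneg _
    have hs_nonneg : 0 ≤ ∑ m, (y j m - ybar m) ^ 2 := Finset.sum_nonneg fun m _ => sq_nonneg _
    have hamgm := two_mul_le_add_sq √(∑ m, (y j m - ybar m) ^ 2) √(x j)
    rw [Real.sq_sqrt hx_nonneg, Real.sq_sqrt hs_nonneg] at hamgm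
    rw [hswap]
    linarith [mul_le_mul_of_nonneg_left hamgm (hP_nonneg j)]
  calc _ ≤ ∑ j, (P j * ∑ m, (y j m - ybar m) ^ 2 + P j * x j) / 2 :=
        Finset.sum_le_sum fun j _ => hterm j
    _ = (∑ j, P j * ∑ m, (y j m - ybar m) ^ 2 + ∑ j, P j * x j) / 2 := by
        rw [← Finset.sum_div, Finset.sum_add_distrib]
    _ ≤ c := by linarith
end
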